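/- arXiv:2209.05215 — 3 statements merged into one kernel-verified Lean document; each statement's English description precedes it below -/
import Mathlib

section
/- Let G be a group, L a subgroup of G, and Z a subgroup of the center of L. Let g ∈ G be an element that normalizes L and normalizes Z, and assume that L = Z·[L,L], i.e. every element of L can be written as a product of an element of Z and an element of the derived subgroup [L,L]. Then {z·(l g l⁻¹) : z ∈ Z, l ∈ L} = {z·(d g d⁻¹) : z ∈ Z, d ∈ [L,L]}. -/
/-- Let `G` be a group, `L` a subgroup, and `Z` a subgroup contained in the center of `L`.
If `g` normalizes `L` and `Z`, and `L = Z * [L, L]`, then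
`Z * (L-orbit of g) = Z * ([L,L]-orbit of g)`. -/
theorem center_times_orbit_eq_center_times_derived_orbit
    {G : Type*} [Group G] (L Z : Subgroup G)
    (hZL : (Z : Set G) ⊆ (L : Set G))
    (hZcentral : ∀ z ∈ Z, ∀ l ∈ L, z * l = l * z)
    (g : G)
    (hgL : ∀ l ∈ L, g * l * g⁻¹ ∈ L)
    (hgZ : ∀ z ∈ Z, g * z * g⁻¹ ∈ Z)
    (hgen : ∀ l ∈ L, ∃ z ∈ Z, ∃ d ∈ ⁅L, L⁆, l = z * d) :
    {x : G | ∃ z ∈ Z, ∃ l ∈ L, x = z * (l * g * l⁻¹)}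
      = {x : G | ∃ z ∈ Z, ∃ d ∈ ⁅L, L⁆, x = z * (d * g * d⁻¹)} := by
  have hL : ⁅L, L⁆ ≤ L := L.commutator_le_self
  ext x
  constructor
  · rintro ⟨z, hz, l, hl, rfl⟩
    obtain ⟨w, hw, d, hd, rfl⟩ := hgen l hl
    have hgw : g * w⁻¹ * g⁻¹ ∈ Z := hgZ _ (inv_mem hw)
    have hcomm : g * w⁻¹ * g⁻¹ * d = d * (g * w⁻¹ * g⁻¹) := hZcentral _ hgw d (hL hd)
    refine ⟨z * w * (g * w⁻¹ * g⁻¹), mul_mem (mul_mem hz hw) hgw, d, hd, ?_⟩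
    calc z * (w * d * g * (w * d)⁻¹)
        = z * w * d * g * (d⁻¹ * w⁻¹) := by group
      _ = z * w * d * g * (w⁻¹ * d⁻¹) := by
        rw [hZcentral _ (inv_mem hw) _ (inv_mem (hL hd))]
      _ = z * w * (d * (g * w⁻¹ * g⁻¹)) * g * d⁻¹ := by group
      _ = z * w * (g * w⁻¹ * g⁻¹) * (d * g * d⁻¹) := by rw [← hcomm]; group
  · rintro ⟨z, hz, d, hd, rfl⟩
    exact ⟨z, hz, d, hL hd, rfl⟩
end

section
/- Let K be a field of characteristic 2 and let x ∈ SL(3,K). Then the matrix y = x·τ(x)⁻¹ satisfies y₁₂ = y₂₃, i.e. the (1,2)-entry of y equals its (2,3)-entry. -/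
open Matrix

/-- The antidiagonal matrix `J` whose `(i,j)` entry (0-based) is `1` if `i + j + 1 = n`
and `0` otherwise. -/
def antidiagJ (n : ℕ) (K : Type*) [Field K] : Matrix (Fin n) (Fin n) K :=
  Matrix.of fun i j => if (i : ℕ) + (j : ℕ) + 1 = n then 1 else 0

/-- The map `τ(X) = J ⬝ (Xᵀ)⁻¹ ⬝ J` on matrices. -/
noncomputable def tauMat (n : ℕ) (K : Type*) [Field K]
    (X : Matrix (Fin n) (Fin n) K) : Matrix (Fin n) (Fin n) K :=
  antidiagJ n K * (Xᵀ)⁻¹ * antidiagJ n K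

theorem antidiagJ_apply_eq_ite_rev {n : ℕ} {K : Type*} [Field K] (i j : Fin n) :
    antidiagJ n K i j = if i = j.rev then 1 else 0 := by
  simp only [antidiagJ, Matrix.of_apply, Fin.ext_iff, Fin.val_rev]
  congr 1
  grind

theorem mul_antidiagJ_apply {n : ℕ} {K : Type*} [Field K] (A : Matrix (Fin n) (Fin n) K)
    (i j : Fin n) : (A * antidiagJ n K) i j = A i j.rev := by
  simp [Matrix.mul_apply, antidiagJ_apply_eq_ite_rev]

theorem antidiagJ_mul_self (n : ℕ) (K : Type*) [Field K] :
    antidiagJ n K * antidiagJ n K = 1 := by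
  ext i j
  simp [mul_antidiagJ_apply, antidiagJ_apply_eq_ite_rev, Matrix.one_apply]

theorem transpose_antidiagJ (n : ℕ) (K : Type*) [Field K] :
    (antidiagJ n K)ᵀ = antidiagJ n K := by
  ext i j
  simp [antidiagJ, add_comm]

theorem inv_tauMat {n : ℕ} {K : Type*} [Field K] {X : Matrix (Fin n) (Fin n) K}
    (hX : IsUnit X.det) : (tauMat n K X)⁻¹ = antidiagJ n K * Xᵀ * antidiagJ n K := by
  rw [tauMat, Matrix.mul_inv_rev, Matrix.mul_inv_rev,
    Matrix.nonsing_inv_nonsing_inv _ (by rwa [Matrix.det_transpose]),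
    Matrix.inv_eq_right_inv (antidiagJ_mul_self n K), Matrix.mul_assoc]

/-- The matrix `x · τ(x)⁻¹` is symmetric about the antidiagonal. -/
theorem mul_inv_tauMat_apply_rev {n : ℕ} {K : Type*} [Field K] {X : Matrix (Fin n) (Fin n) K}
    (hX : IsUnit X.det) (i j : Fin n) :
    (X * (tauMat n K X)⁻¹) i j = (X * (tauMat n K X)⁻¹) j.rev i.rev := by
  have hsymm : (X * (antidiagJ n K * Xᵀ)).IsSymm := by
    simp [Matrix.IsSymm, Matrix.transpose_mul, transpose_antidiagJ, Matrix.mul_assoc]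
  rw [inv_tauMat hX, ← Matrix.mul_assoc, mul_antidiagJ_apply, mul_antidiagJ_apply, Fin.rev_rev,
    hsymm.apply]

/-- In characteristic `2`, for `x ∈ SL(3, K)` the matrix `y = x · τ(x)⁻¹` has equal
`(1,2)` and `(2,3)` entries (written 0-based as `(0,1)` and `(1,2)`). -/
theorem entry_condition_of_tau_twisted_orbit (K : Type*) [Field K] [CharP K 2]
    (x : Matrix.SpecialLinearGroup (Fin 3) K) :
    ((x : Matrix (Fin 3) (Fin 3) K) * (tauMat 3 K (x : Matrix (Fin 3) (Fin 3) K))⁻¹) 0 1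
      = ((x : Matrix (Fin 3) (Fin 3) K) * (tauMat 3 K (x : Matrix (Fin 3) (Fin 3) K))⁻¹) 1 2 := by
  exact mul_inv_tauMat_apply_rev (by simp) 0 1
end

section
/- Let K be an algebraically closed field of characteristic 2 and let u₁ ∈ SL(3,K) be the matrix with rows (1,1,0), (0,1,0), (0,0,1). Then: (i) for every upper unitriangular matrix ā ∈ SL(3,K) there exists x ∈ SL(3,K) such that x·ā·τ(x)⁻¹ = Id or x·ā·τ(x)⁻¹ = u₁; and (ii) there is no x ∈ SL(3,K) with x·τ(x)⁻¹ = u₁. Hence exactly two SL(3,K)-conjugacy orbits of SL(3,K)⋊⟨τ⟩ are represented among the elements āτ with ā upper unitriangular: the orbit of τ and the orbit of u₁τ. -/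
open Matrix

lemma antidiagJ_three (K : Type*) [Field K] :
    antidiagJ 3 K = !![0, 0, 1; 0, 1, 0; 1, 0, 0] := by
  ext i j
  fin_cases i <;> fin_cases j <;> simp [antidiagJ]

lemma antidiagJ_three_mul_self (K : Type*) [Field K] :
    antidiagJ 3 K * antidiagJ 3 K = 1 := by
  rw [antidiagJ_three]
  ext i j
  fin_cases i <;> fin_cases j <;> simp [Matrix.mul_apply, Fin.sum_univ_three]

lemma inv_tauMat_three {K : Type*} [Field K] (x : Matrix (Fin 3) (Fin 3) K) (hx : IsUnit x.det) :
    (tauMat 3 K x)⁻¹ = antidiagJ 3 K * xᵀ * antidiagJ 3 K := by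
  have hJ : (antidiagJ 3 K)⁻¹ = antidiagJ 3 K :=
    Matrix.inv_eq_right_inv (antidiagJ_three_mul_self K)
  rw [tauMat, Matrix.mul_inv_rev, Matrix.mul_inv_rev, hJ,
    Matrix.nonsing_inv_nonsing_inv _ (by rwa [Matrix.det_transpose]), Matrix.mul_assoc]

/-- The twisted conjugate of an upper unitriangular matrix by an upper triangular matrix with
middle diagonal entry `1` and zero corner. -/
lemma twisted_conj_upper {K : Type*} [Field K] (u p s t a b c : K) (h : u * t = 1) :
    !![u, p, 0; 0, 1, s; 0, 0, t] * !![1, a, b; 0, 1, c; 0, 0, 1] *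
        (tauMat 3 K !![u, p, 0; 0, 1, s; 0, 0, t])⁻¹
      = !![1, u * a + u * s + p, u * (u * b + p * a + p * c) + p * p;
        0, 1, u * c + p + s * u; 0, 0, 1] := by
  have hdet : IsUnit (!![u, p, 0; 0, 1, s; 0, 0, t] : Matrix (Fin 3) (Fin 3) K).det := by
    simp [Matrix.det_fin_three, h]
  have htr : !![u, p, 0; 0, 1, s; 0, 0, t]ᵀ = !![u, 0, 0; p, 1, 0; 0, s, t] := by
    ext i j
    fin_cases i <;> fin_cases j <;> rfl
  rw [inv_tauMat_three _ hdet, antidiagJ_three, htr]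
  ext i j
  fin_cases i <;> fin_cases j <;>
    simp [Matrix.mul_apply, Fin.sum_univ_three] <;> grind

lemma exists_twisted_conj_upper {K : Type*} [Field K] (u p s t a b c : K) (h : u * t = 1) :
    ∃ x : Matrix.SpecialLinearGroup (Fin 3) K,
      (x : Matrix (Fin 3) (Fin 3) K) * !![1, a, b; 0, 1, c; 0, 0, 1] *
          (tauMat 3 K (x : Matrix (Fin 3) (Fin 3) K))⁻¹
        = !![1, u * a + u * s + p, u * (u * b + p * a + p * c) + p * p;
          0, 1, u * c + p + s * u; 0, 0, 1] :=
  ⟨⟨!![u, p, 0; 0, 1, s; 0, 0, t], by simp [Matrix.det_fin_three, h]⟩,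
    twisted_conj_upper u p s t a b c h⟩

lemma eq_of_upper_unitriangular {K : Type*} [Field K] (m : Matrix (Fin 3) (Fin 3) K)
    (hm : m.BlockTriangular id) (h1 : ∀ i, m i i = 1) :
    m = !![1, m 0 1, m 0 2; 0, 1, m 1 2; 0, 0, 1] := by
  have h10 : m 1 0 = 0 := hm (by decide)
  have h20 : m 2 0 = 0 := hm (by decide)
  have h21 : m 2 1 = 0 := hm (by decide)
  ext i j
  fin_cases i <;> fin_cases j <;> simp [h1, h10, h20, h21]

lemma exists_sq_add_self_add_eq_zero {K : Type*} [Field K] [IsAlgClosed K] (d : K) :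
    ∃ p : K, p ^ 2 + p + d = 0 := by
  obtain ⟨p, hp⟩ := IsAlgClosed.exists_root
    (Polynomial.C 1 * Polynomial.X ^ 2 + Polynomial.C 1 * Polynomial.X + Polynomial.C d)
    (by rw [Polynomial.degree_quadratic one_ne_zero]; decide)
  exact ⟨p, by simpa [Polynomial.IsRoot] using hp⟩

/-- Over an algebraically closed field of characteristic `2`: (i) every upper
unitriangular `ā ∈ SL(3, K)` is twisted-conjugate (by some `x ∈ SL(3, K)`,
`ā ↦ x · ā · τ(x)⁻¹`) to `1` or to `u₁ = !![1,1,0; 0,1,0; 0,0,1]`; and (ii) no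
`x ∈ SL(3, K)` satisfies `x · τ(x)⁻¹ = u₁`. Hence exactly the two `SL(3, K)`-orbits
of `τ` and of `u₁τ` are represented among the elements `āτ` with `ā` upper
unitriangular. -/
theorem two_unipotent_twisted_orbits
    (K : Type*) [Field K] [IsAlgClosed K] [CharP K 2] :
    (∀ abar : Matrix (Fin 3) (Fin 3) K, abar.BlockTriangular id → (∀ i, abar i i = 1) →
      ∃ x : Matrix.SpecialLinearGroup (Fin 3) K,
        (x : Matrix (Fin 3) (Fin 3) K) * abar *
            (tauMat 3 K (x : Matrix (Fin 3) (Fin 3) K))⁻¹ = 1 ∨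
        (x : Matrix (Fin 3) (Fin 3) K) * abar *
            (tauMat 3 K (x : Matrix (Fin 3) (Fin 3) K))⁻¹
          = !![1, 1, 0; 0, 1, 0; 0, 0, 1]) ∧
    (¬ ∃ x : Matrix.SpecialLinearGroup (Fin 3) K,
      (x : Matrix (Fin 3) (Fin 3) K) * (tauMat 3 K (x : Matrix (Fin 3) (Fin 3) K))⁻¹
        = !![1, 1, 0; 0, 1, 0; 0, 0, 1]) := by
  have h2 : (2 : K) = 0 := CharTwo.two_eq_zero
  constructor
  · intro m hm hm1
    rw [eq_of_upper_unitriangular m hm hm1]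
    generalize m 0 1 = a, m 0 2 = b, m 1 2 = c
    by_cases hac : a = c
    · subst hac
      obtain ⟨r, hr⟩ := IsAlgClosed.exists_pow_nat_eq (b + a ^ 2) (n := 2) two_pos
      obtain ⟨x, hx⟩ := exists_twisted_conj_upper 1 (a + r) r 1 a b a (mul_one 1)
      refine ⟨x, Or.inl ?_⟩
      rw [hx, Matrix.one_fin_three]
      congr! 4 <;> grind
    · have hd : a + c ≠ 0 := fun h => hac (by grind)
      obtain ⟨p, hp⟩ := exists_sq_add_self_add_eq_zero ((a + c)⁻¹ ^ 2 * b)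
      obtain ⟨x, hx⟩ := exists_twisted_conj_upper (a + c)⁻¹ p (p * (a + c) + c) (a + c) a b c
        (inv_mul_cancel₀ hd)
      refine ⟨x, Or.inr ?_⟩
      rw [hx]
      congr! 4 <;> grind
  · rintro ⟨x, hx⟩
    rw [inv_tauMat_three _ (by simp)] at hx
    have hJt : (antidiagJ 3 K)ᵀ = antidiagJ 3 K := by
      ext i j
      simp [antidiagJ, add_comm]
    have hsymm : ((x : Matrix (Fin 3) (Fin 3) K) * antidiagJ 3 K * (x : Matrix _ _ K)ᵀ).IsSymm := by
      simp [Matrix.IsSymm, hJt, Matrix.mul_assoc]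
    have heq : (x : Matrix (Fin 3) (Fin 3) K) * antidiagJ 3 K * (x : Matrix _ _ K)ᵀ
        = !![1, 1, 0; 0, 1, 0; 0, 0, 1] * antidiagJ 3 K := by
      rw [← hx]
      simp only [Matrix.mul_assoc, antidiagJ_three_mul_self, Matrix.mul_one]
    rw [heq, antidiagJ_three] at hsymm
    have := hsymm.apply 0 1
    simp [Matrix.mul_apply, Fin.sum_univ_three] at this
end
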